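/- 4-approximation (welfare form): for every nondecreasing c : [0,1] → ℝ and every Borel probability measure ν on ℝ with ∫|v| dν(v) < ∞, one has (u_B + u_S)/2 ≥ FB / 4, where FB := ∫_ℝ ∫₀¹ max(v − c(q), 0) dq dν(v), u_B := ∫_ℝ sup_{p ∈ ℝ} ((v − p)·x(p)) dν(v), and u_S := ∫₀¹ sup_{p ∈ ℝ} ((p − c(q))·ν({v : v ≥ p})) dq. -/

import Mathlib

open MeasureTheory Set

/-- The probability that the seller (with cost curve `c` on quantiles in `[0,1]`)
accepts a price `p`: the Lebesgue measure of `{q ∈ [0,1] : c q ≤ p}`. -/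
noncomputable def accProb (c : ℝ → ℝ) (p : ℝ) : ℝ :=
  (volume {q : ℝ | q ∈ Icc (0:ℝ) 1 ∧ c q ≤ p}).toReal

/-- First-best gains from trade, in expectation over the buyer value `v ∼ ν`. -/
noncomputable def FB (c : ℝ → ℝ) (ν : Measure ℝ) : ℝ :=
  ∫ v, (∫ q in (0:ℝ)..1, max (v - c q) 0) ∂ν

/-- The buyer's expected optimal proposer utility. -/
noncomputable def uB (c : ℝ → ℝ) (ν : Measure ℝ) : ℝ :=
  ∫ v, (⨆ p : ℝ, (v - p) * accProb c p) ∂ν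

/-- The seller's expected optimal proposer utility. -/
noncomputable def uS (c : ℝ → ℝ) (ν : Measure ℝ) : ℝ :=
  ∫ q in (0:ℝ)..1, ⨆ p : ℝ, (p - c q) * (ν {v : ℝ | p ≤ v}).toReal

/-- The upper quantile function of `ν`: the largest `z` with `ν [z, ∞) ≥ t`. -/
noncomputable def upperQuantile (ν : Measure ℝ) (t : ℝ) : ℝ :=
  sSup {z | t ≤ ν.real (Ici z)}

lemma antitone_measureReal_Ici (ν : Measure ℝ) [IsFiniteMeasure ν] :
    Antitone fun z => ν.real (Ici z) :=
  fun _ _ h => measureReal_mono (Ici_subset_Ici.2 h)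

lemma measureReal_Ici_eq_cdf (ν : Measure ℝ) [IsProbabilityMeasure ν] (z : ℝ) :
    ν.real (Ici z) = ProbabilityTheory.cdf (ν.map (fun x => -x)) (-z) := by
  have : IsProbabilityMeasure (ν.map (fun x : ℝ => -x)) :=
    Measure.isProbabilityMeasure_map measurable_neg.aemeasurable
  rw [ProbabilityTheory.cdf_eq_real, map_measureReal_apply measurable_neg measurableSet_Iic]
  congr 1
  ext x
  simp

lemma le_upperQuantile_iff (ν : Measure ℝ) [IsProbabilityMeasure ν] {t : ℝ} (h0 : 0 < t)
    (h1 : t < 1) (z : ℝ) : z ≤ upperQuantile ν t ↔ t ≤ ν.real (Ici z) := by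
  set F := ProbabilityTheory.cdf (ν.map (fun x => -x))
  have hG : ∀ z, ν.real (Ici z) = F (-z) := measureReal_Ici_eq_cdf ν
  have hbdd : BddAbove {z | t ≤ ν.real (Ici z)} := by
    obtain ⟨a, ha⟩ := ((ProbabilityTheory.tendsto_cdf_atBot _).eventually_lt_const h0).exists
    refine ⟨-a, fun z hz => ?_⟩
    by_contra! h
    have := F.mono (show -z ≤ a by linarith)
    rw [mem_ofPred_eq, hG] at hz
    linarith
  have hne : {z | t ≤ ν.real (Ici z)}.Nonempty := by
    have : IsProbabilityMeasure (ν.map (fun x : ℝ => -x)) :=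
      Measure.isProbabilityMeasure_map measurable_neg.aemeasurable
    obtain ⟨a, ha⟩ :=
      ((ProbabilityTheory.tendsto_cdf_atTop (ν.map fun x => -x)).eventually_const_lt h1).exists
    exact ⟨-a, by rw [mem_ofPred_eq, hG, neg_neg]; exact ha.le⟩
  refine ⟨fun h => ?_, fun h => le_csSup hbdd h⟩
  refine le_trans ?_ (antitone_measureReal_Ici ν h)
  have hlim : Filter.Tendsto F (nhdsWithin (-upperQuantile ν t) (Ioi _))
      (nhds (F (-upperQuantile ν t))) :=
    (F.right_continuous _).mono_left (nhdsWithin_mono _ Ioi_subset_Ici_self)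
  beta_reduce
  rw [hG]
  refine ge_of_tendsto hlim ?_
  filter_upwards [self_mem_nhdsWithin] with y hy
  obtain ⟨w, hw, hyw⟩ := exists_lt_of_lt_csSup hne (show -y < upperQuantile ν t from by
    have : -upperQuantile ν t < y := hy
    linarith)
  rw [mem_ofPred_eq, hG] at hw
  exact hw.trans (F.mono (by linarith))

lemma aemeasurable_upperQuantile (ν : Measure ℝ) [IsProbabilityMeasure ν] :
    AEMeasurable (upperQuantile ν) (volume.restrict (Ioo 0 1)) := by
  refine aemeasurable_restrict_of_antitoneOn measurableSet_Ioo fun s hs t ht hst => ?_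
  rw [le_upperQuantile_iff ν hs.1 hs.2]
  exact hst.trans ((le_upperQuantile_iff ν ht.1 ht.2 _).1 le_rfl)

lemma map_upperQuantile (ν : Measure ℝ) [IsProbabilityMeasure ν] :
    (volume.restrict (Ioo 0 1)).map (upperQuantile ν) = ν := by
  refine Measure.ext_of_Ici _ _ fun z => ?_
  rw [Measure.map_apply_of_aemeasurable (aemeasurable_upperQuantile ν) measurableSet_Ici,
    Measure.restrict_apply' measurableSet_Ioo]
  have hle : ν.real (Ici z) ≤ 1 := measureReal_le_one
  have hset : upperQuantile ν ⁻¹' Ici z ∩ Ioo 0 1 = Ioc 0 (ν.real (Ici z)) ∩ Iio 1 := by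
    ext t
    simp only [mem_inter_iff, mem_preimage, mem_Ici, mem_Ioo, mem_Ioc, mem_Iio]
    constructor
    · rintro ⟨h, h0, h1⟩
      exact ⟨⟨h0, (le_upperQuantile_iff ν h0 h1 z).1 h⟩, h1⟩
    · rintro ⟨⟨h0, h⟩, h1⟩
      exact ⟨(le_upperQuantile_iff ν h0 h1 z).2 h, h0, h1⟩
  have hvol : volume (Ioc 0 (ν.real (Ici z)) ∩ Iio 1) = volume (Ioc 0 (ν.real (Ici z))) := by
    refine measure_congr ?_
    filter_upwards [(measure_eq_zero_iff_ae_notMem (μ := volume)).1 (Real.volume_singleton (a := 1))]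
      with t ht
    refine propext ⟨fun h => h.1, fun h => ⟨h, lt_of_le_of_ne (h.2.trans hle) ht⟩⟩
  rw [hset, hvol, Real.volume_Ioc, sub_zero, ofReal_measureReal]

lemma lintegral_gains_eq (σ ν : Measure ℝ) [IsFiniteMeasure σ] [IsFiniteMeasure ν] :
    ∫⁻ v, ∫⁻ x, ENNReal.ofReal (v - x) ∂σ ∂ν = ∫⁻ z, σ (Iic z) * ν (Ici z) := by
  have hF : Measurable fun z => σ (Iic z) :=
    Monotone.measurable fun _ _ h => measure_mono (Iic_subset_Iic.2 h)
  calc ∫⁻ v, ∫⁻ x, ENNReal.ofReal (v - x) ∂σ ∂ν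
      = ∫⁻ v, ∫⁻ x, (∫⁻ z, {p : ℝ × ℝ | p.1 ≤ p.2 ∧ p.2 ≤ v}.indicator 1 (x, z)) ∂σ ∂ν := by
        refine lintegral_congr fun v => lintegral_congr fun x => ?_
        rw [← Real.volume_Icc, ← lintegral_indicator_one measurableSet_Icc]
        rfl
    _ = ∫⁻ v, (∫⁻ z, {p : ℝ × ℝ | p.2 ≤ p.1}.indicator (fun p => σ (Iic p.2)) (v, z)) ∂ν := by
        refine lintegral_congr fun v => ?_
        rw [lintegral_lintegral_swap]
        · refine lintegral_congr fun z => ?_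
          by_cases hz : z ≤ v
          · rw [indicator_of_mem (by exact hz), ← lintegral_indicator_one measurableSet_Iic]
            refine lintegral_congr fun x => ?_
            simp [indicator, hz]
          · simp [hz]
        · refine (Measurable.indicator measurable_one ?_).aemeasurable
          measurability
    _ = ∫⁻ z, σ (Iic z) * ν (Ici z) := by
        rw [lintegral_lintegral_swap]
        · refine lintegral_congr fun z => ?_
          rw [← lintegral_indicator_const measurableSet_Ici]
          rfl
        · refine (Measurable.indicator (hF.comp measurable_snd) ?_).aemeasurable
          exact measurableSet_le measurable_snd measurable_fst

lemma lintegral_gains_le_two_mul (σ ν : Measure ℝ) [IsProbabilityMeasure σ]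
    [IsProbabilityMeasure ν] {b s : ℝ → ENNReal} (hb : Measurable b)
    (hbuyer : ∀ v p, ENNReal.ofReal (v - p) * σ (Iic p) ≤ b v)
    (hseller : ∀ x p, ENNReal.ofReal (p - x) * ν (Ici p) ≤ s x) :
    ∫⁻ v, ∫⁻ x, ENNReal.ofReal (v - x) ∂σ ∂ν ≤ 2 * (∫⁻ v, b v ∂ν + ∫⁻ x, s x ∂σ) := by
  set G : ℝ → ℝ := fun z => ν.real (Ici z)
  have hGanti : Antitone G := antitone_measureReal_Ici ν
  have hG : Measurable G := hGanti.measurable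
  have hG0 : ∀ z, 0 ≤ G z := fun z => measureReal_nonneg
  have hG1 : ∀ z, G z ≤ 1 := fun z => measureReal_le_one
  have hQ : ∀ {t : ℝ}, 0 < t → t < 1 → ∀ z, z ≤ upperQuantile ν t ↔ t ≤ G z :=
    fun h0 h1 z => le_upperQuantile_iff ν h0 h1 z
  set H : ℝ → ENNReal := fun t => σ {x | t ≤ G x}
  have hH : Measurable H :=
    Antitone.measurable fun _ _ hst => measure_mono fun _ hx => hst.trans hx
  -- A buyer at upper quantile `t` offers the price at upper quantile `2 * t`.
  have hB : ∫⁻ z, ENNReal.ofReal (G z / 2) * σ {x | 2 * G z < G x} ≤ ∫⁻ v, b v ∂ν := by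
    calc ∫⁻ z, ENNReal.ofReal (G z / 2) * σ {x | 2 * G z < G x}
        ≤ ∫⁻ z, ∫⁻ t in Ioo 0 (1 / 2), {p : ℝ × ℝ | p.1 ≤ G p.2 ∧ G p.2 < 2 * p.1}.indicator
            (fun p => H (2 * p.1)) (t, z) := by
          refine lintegral_mono fun z => ?_
          rcases lt_or_ge (2 * G z) 1 with hlt | hge
          · calc ENNReal.ofReal (G z / 2) * σ {x | 2 * G z < G x}
                = ∫⁻ t in Ioo 0 (1 / 2), (Ioc (G z / 2) (G z)).indicator
                    (fun _ => σ {x | 2 * G z < G x}) t := by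
                  rw [lintegral_indicator_const measurableSet_Ioc,
                    Measure.restrict_apply measurableSet_Ioc, inter_eq_left.2, Real.volume_Ioc,
                    mul_comm]
                  · ring_nf
                  · intro t ht
                    exact ⟨by linarith [ht.1, hG0 z], by linarith [ht.2]⟩
              _ ≤ _ := by
                  refine lintegral_mono fun t => ?_
                  by_cases ht : t ∈ Ioc (G z / 2) (G z)
                  swap
                  · simp [ht]
                  rw [indicator_of_mem ht]
                  have ht' : t ≤ G z ∧ G z < 2 * t := ⟨ht.2, by linarith [ht.1]⟩
                  simp only [indicator, mem_ofPred_eq, ht', and_self, if_true]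
                  refine measure_mono fun x hx => ?_
                  simp only [mem_ofPred_eq] at hx ⊢
                  linarith
          · have : {x | 2 * G z < G x} = ∅ := by
              ext x
              simpa using (hG1 x).trans hge
            simp [this]
      _ = ∫⁻ t in Ioo 0 (1 / 2), ∫⁻ z, {p : ℝ × ℝ | p.1 ≤ G p.2 ∧ G p.2 < 2 * p.1}.indicator
            (fun p => H (2 * p.1)) (t, z) := by
          rw [lintegral_lintegral_swap]
          have hm : MeasurableSet {p : ℝ × ℝ | p.1 ≤ G p.2 ∧ G p.2 < 2 * p.1} :=
            (measurableSet_le measurable_fst (hG.comp measurable_snd)).inter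
              (measurableSet_lt (hG.comp measurable_snd) (measurable_fst.const_mul 2))
          have := (hH.comp (measurable_fst.const_mul 2)).indicator hm
          exact (this.comp measurable_swap).aemeasurable
      _ ≤ ∫⁻ t in Ioo 0 (1 / 2), b (upperQuantile ν t) := by
          refine setLIntegral_mono_ae' measurableSet_Ioo (Filter.Eventually.of_forall ?_)
          rintro t ⟨ht0, ht1⟩
          refine le_trans (le_of_eq ?_) (hbuyer _ (upperQuantile ν (2 * t)))
          have h1 : Ioc (upperQuantile ν (2 * t)) (upperQuantile ν t)
              = {z | t ≤ G z ∧ G z < 2 * t} := by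
            ext z
            rw [mem_Ioc, ← not_le, hQ (by linarith) (by linarith), hQ ht0 (by linarith), not_le]
            exact and_comm
          have h2 : Iic (upperQuantile ν (2 * t)) = {x | 2 * t ≤ G x} := by
            ext x
            exact hQ (by linarith) (by linarith) x
          rw [← Real.volume_Ioc, h2, mul_comm, ← lintegral_indicator_const measurableSet_Ioc, h1]
          rfl
      _ ≤ ∫⁻ t in Ioo 0 1, b (upperQuantile ν t) :=
          lintegral_mono_set (Ioo_subset_Ioo_right (by norm_num))
      _ = ∫⁻ v, b v ∂ν := by
          conv_rhs => rw [← map_upperQuantile ν]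
          rw [lintegral_map' hb.aemeasurable (aemeasurable_upperQuantile ν)]
  -- A seller with cost `x` offers the price at upper quantile `G x / 2`.
  have hS : ∫⁻ z, ENNReal.ofReal (G z / 2) * σ {x | x ≤ z ∧ G x ≤ 2 * G z} ≤ ∫⁻ x, s x ∂σ := by
    have hm : MeasurableSet {p : ℝ × ℝ | p.1 ≤ p.2 ∧ G p.1 ≤ 2 * G p.2} :=
      (measurableSet_le measurable_fst measurable_snd).inter
        (measurableSet_le (hG.comp measurable_fst) ((hG.comp measurable_snd).const_mul 2))
    calc ∫⁻ z, ENNReal.ofReal (G z / 2) * σ {x | x ≤ z ∧ G x ≤ 2 * G z}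
        ≤ ∫⁻ z, ∫⁻ x, {p : ℝ × ℝ | p.1 ≤ p.2 ∧ G p.1 ≤ 2 * G p.2}.indicator
            (fun p => ENNReal.ofReal (G p.1 / 2)) (x, z) ∂σ := by
          refine lintegral_mono fun z => ?_
          have hmz : MeasurableSet {x | x ≤ z ∧ G x ≤ 2 * G z} :=
            measurableSet_Iic.inter (measurableSet_le hG measurable_const)
          rw [← lintegral_indicator_const hmz]
          refine lintegral_mono fun x => ?_
          by_cases hx : x ≤ z ∧ G x ≤ 2 * G z
          · simp only [indicator, mem_ofPred_eq, hx, and_self, if_true]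
            have := hGanti hx.1
            gcongr
          · simp [indicator, hx]
      _ = ∫⁻ x, (∫⁻ z, {p : ℝ × ℝ | p.1 ≤ p.2 ∧ G p.1 ≤ 2 * G p.2}.indicator
            (fun p => ENNReal.ofReal (G p.1 / 2)) (x, z)) ∂σ := by
          rw [lintegral_lintegral_swap]
          have := ((hG.comp measurable_fst).div_const 2).ennreal_ofReal.indicator hm
          exact (this.comp measurable_swap).aemeasurable
      _ ≤ ∫⁻ x, s x ∂σ := by
          refine lintegral_mono fun x => ?_
          rcases (hG0 x).eq_or_lt with h0 | hpos
          · simp [indicator, ← h0]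
          have hx0 : 0 < G x / 2 := by linarith
          have hx1 : G x / 2 < 1 := by linarith [hG1 x]
          refine le_trans ?_ (hseller x (upperQuantile ν (G x / 2)))
          have h1 : Icc x (upperQuantile ν (G x / 2)) = {z | x ≤ z ∧ G x ≤ 2 * G z} := by
            ext z
            rw [mem_Icc, hQ hx0 hx1, div_le_iff₀' two_pos]
            rfl
          have h2 : G x / 2 ≤ G (upperQuantile ν (G x / 2)) := (hQ hx0 hx1 _).1 le_rfl
          calc _ = ∫⁻ z, (Icc x (upperQuantile ν (G x / 2))).indicator
                (fun _ => ENNReal.ofReal (G x / 2)) z := by rw [h1]; rfl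
            _ = ENNReal.ofReal (upperQuantile ν (G x / 2) - x) * ENNReal.ofReal (G x / 2) := by
                rw [lintegral_indicator_const measurableSet_Icc, Real.volume_Icc, mul_comm]
            _ ≤ _ := by
                gcongr
                exact (ENNReal.ofReal_le_iff_le_toReal (measure_ne_top _ _)).2 h2
  calc ∫⁻ v, ∫⁻ x, ENNReal.ofReal (v - x) ∂σ ∂ν
      = ∫⁻ z, σ (Iic z) * ν (Ici z) := lintegral_gains_eq σ ν
    _ ≤ ∫⁻ z, 2 * (ENNReal.ofReal (G z / 2) * σ {x | 2 * G z < G x}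
          + ENNReal.ofReal (G z / 2) * σ {x | x ≤ z ∧ G x ≤ 2 * G z}) := by
        refine lintegral_mono fun z => ?_
        have h1 : ν (Ici z) = 2 * ENNReal.ofReal (G z / 2) := by
          rw [← ofReal_measureReal (μ := ν), ← ENNReal.ofReal_ofNat 2,
            ← ENNReal.ofReal_mul (by norm_num), mul_div_cancel₀ _ two_ne_zero]
        have h2 : σ (Iic z) ≤ σ {x | 2 * G z < G x} + σ {x | x ≤ z ∧ G x ≤ 2 * G z} := by
          refine (measure_mono fun x hx => ?_).trans (measure_union_le _ _)
          rcases lt_or_ge (2 * G z) (G x) with h | h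
          · exact Or.inl h
          · exact Or.inr ⟨hx, h⟩
        rw [h1, ← mul_add, mul_comm, mul_assoc]
        gcongr
    _ = 2 * ((∫⁻ z, ENNReal.ofReal (G z / 2) * σ {x | 2 * G z < G x})
          + ∫⁻ z, ENNReal.ofReal (G z / 2) * σ {x | x ≤ z ∧ G x ≤ 2 * G z}) := by
        rw [lintegral_const_mul' _ _ (by norm_num), lintegral_add_left]
        have : Measurable fun z => σ {x | 2 * G z < G x} := by
          refine Monotone.measurable fun z w hzw => measure_mono fun x hx => ?_
          have := hGanti hzw
          simp only [mem_ofPred_eq] at hx ⊢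
          linarith
        exact (hG.div_const 2).ennreal_ofReal.mul this
    _ ≤ _ := by gcongr

lemma accProb_nonneg (c : ℝ → ℝ) (p : ℝ) : 0 ≤ accProb c p := ENNReal.toReal_nonneg

lemma accProb_le_one (c : ℝ → ℝ) (p : ℝ) : accProb c p ≤ 1 := by
  refine ENNReal.toReal_le_of_le_ofReal zero_le_one ?_
  calc volume {q : ℝ | q ∈ Icc (0:ℝ) 1 ∧ c q ≤ p} ≤ volume (Icc (0:ℝ) 1) :=
        measure_mono fun _ hq => hq.1
    _ = ENNReal.ofReal 1 := by simp

lemma ofReal_accProb (c : ℝ → ℝ) (hc : MonotoneOn c (Icc (0:ℝ) 1)) (p : ℝ) :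
    ENNReal.ofReal (accProb c p) = (volume.restrict (Icc (0:ℝ) 1)).map c (Iic p) := by
  rw [Measure.map_apply_of_aemeasurable
    (aemeasurable_restrict_of_monotoneOn measurableSet_Icc hc) measurableSet_Iic,
    Measure.restrict_apply' measurableSet_Icc, inter_comm, accProb, ENNReal.ofReal_toReal]
  · rfl
  · exact ne_top_of_le_ne_top (by simp) (measure_mono (t := Icc (0:ℝ) 1) fun _ hq => hq.1)

lemma buyer_utility_le (c : ℝ → ℝ) (hc : MonotoneOn c (Icc (0:ℝ) 1)) (v p : ℝ) :
    (v - p) * accProb c p ≤ |v| + |c 0| := by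
  rcases lt_or_ge p (c 0) with hp | hp
  · have hempty : {q : ℝ | q ∈ Icc (0:ℝ) 1 ∧ c q ≤ p} = ∅ := by
      ext q
      simp only [mem_ofPred_eq, mem_empty_iff_false, iff_false, not_and, not_le]
      exact fun hq => hp.trans_le (hc ⟨le_rfl, zero_le_one⟩ hq hq.1)
    simp only [accProb, hempty, measure_empty, ENNReal.toReal_zero, mul_zero]
    positivity
  · have h0 : v - p ≤ |v| + |c 0| := by linarith [le_abs_self v, neg_abs_le (c 0)]
    calc (v - p) * accProb c p ≤ (|v| + |c 0|) * accProb c p := by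
          gcongr
          exact accProb_nonneg c p
      _ ≤ |v| + |c 0| := mul_le_of_le_one_right (by positivity) (accProb_le_one c p)

lemma bddAbove_buyer_utility (c : ℝ → ℝ) (hc : MonotoneOn c (Icc (0:ℝ) 1)) (v : ℝ) :
    BddAbove (range fun p => (v - p) * accProb c p) :=
  ⟨|v| + |c 0|, by rintro _ ⟨p, rfl⟩; exact buyer_utility_le c hc v p⟩

lemma monotone_iSup_buyer_utility (c : ℝ → ℝ) (hc : MonotoneOn c (Icc (0:ℝ) 1)) :
    Monotone fun v => ⨆ p : ℝ, (v - p) * accProb c p :=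
  fun _ w h => ciSup_mono (bddAbove_buyer_utility c hc w) fun p =>
    mul_le_mul_of_nonneg_right (by linarith) (accProb_nonneg c p)

lemma iSup_buyer_utility_nonneg (c : ℝ → ℝ) (hc : MonotoneOn c (Icc (0:ℝ) 1)) (v : ℝ) :
    0 ≤ ⨆ p : ℝ, (v - p) * accProb c p :=
  le_ciSup_of_le (bddAbove_buyer_utility c hc v) v (by simp)

lemma integrable_iSup_buyer_utility (c : ℝ → ℝ) (hc : MonotoneOn c (Icc (0:ℝ) 1))
    (ν : Measure ℝ) [IsFiniteMeasure ν] (hν : Integrable (fun v : ℝ => v) ν) :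
    Integrable (fun v => ⨆ p : ℝ, (v - p) * accProb c p) ν := by
  refine Integrable.mono' (hν.abs.add (integrable_const |c 0|))
    (monotone_iSup_buyer_utility c hc).measurable.aestronglyMeasurable ?_
  refine Filter.Eventually.of_forall fun v => ?_
  rw [Real.norm_of_nonneg (iSup_buyer_utility_nonneg c hc v)]
  exact ciSup_le fun p => buyer_utility_le c hc v p

lemma bddAbove_seller_utility (ν : Measure ℝ) [IsFiniteMeasure ν]
    (hν : Integrable (fun v : ℝ => v) ν) (x : ℝ) :
    BddAbove (range fun p => (p - x) * (ν {v : ℝ | p ≤ v}).toReal) := by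
  refine ⟨∫ v, |v - x| ∂ν, ?_⟩
  rintro _ ⟨p, rfl⟩
  have hint : Integrable (fun v => |v - x|) ν := (hν.sub (integrable_const x)).abs
  rcases le_or_gt p x with hp | hp
  · exact (mul_nonpos_of_nonpos_of_nonneg (by linarith) ENNReal.toReal_nonneg).trans
      (integral_nonneg fun _ => abs_nonneg _)
  · refine le_trans ?_ (mul_meas_ge_le_integral_of_nonneg
      (Filter.Eventually.of_forall fun _ => abs_nonneg _) hint (p - x))
    refine mul_le_mul_of_nonneg_left (measureReal_mono fun v hv => ?_) (by linarith)
    have hv' : p ≤ v := hv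
    exact (show p - x ≤ v - x by linarith).trans (le_abs_self _)

lemma antitone_iSup_seller_utility (ν : Measure ℝ) [IsFiniteMeasure ν]
    (hν : Integrable (fun v : ℝ => v) ν) :
    Antitone fun x => ⨆ p : ℝ, (p - x) * (ν {v : ℝ | p ≤ v}).toReal :=
  fun x _ h => ciSup_mono (bddAbove_seller_utility ν hν x) fun p =>
    mul_le_mul_of_nonneg_right (by linarith) ENNReal.toReal_nonneg

lemma iSup_seller_utility_nonneg (ν : Measure ℝ) [IsFiniteMeasure ν]
    (hν : Integrable (fun v : ℝ => v) ν) (x : ℝ) :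
    0 ≤ ⨆ p : ℝ, (p - x) * (ν {v : ℝ | p ≤ v}).toReal :=
  le_ciSup_of_le (bddAbove_seller_utility ν hν x) x (by simp)

theorem stmt10 (c : ℝ → ℝ) (hc : MonotoneOn c (Icc (0:ℝ) 1))
    (ν : Measure ℝ) [IsProbabilityMeasure ν]
    (hν : Integrable (fun v : ℝ => v) ν) :
    (uB c ν + uS c ν) / 2 ≥ FB c ν / 4 := by
  have hcm : AEMeasurable c (volume.restrict (Icc (0:ℝ) 1)) :=
    aemeasurable_restrict_of_monotoneOn measurableSet_Icc hc
  have : IsProbabilityMeasure (volume.restrict (Icc (0:ℝ) 1)) := ⟨by simp⟩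
  set σ := (volume.restrict (Icc (0:ℝ) 1)).map c with hσ
  have : IsProbabilityMeasure σ := Measure.isProbabilityMeasure_map hcm
  have hb := monotone_iSup_buyer_utility c hc
  have hb0 := iSup_buyer_utility_nonneg c hc
  have hs := antitone_iSup_seller_utility ν hν
  have hs0 := iSup_seller_utility_nonneg ν hν
  set b : ℝ → ℝ := fun v => ⨆ p : ℝ, (v - p) * accProb c p
  set s : ℝ → ℝ := fun x => ⨆ p : ℝ, (p - x) * (ν {v : ℝ | p ≤ v}).toReal
  have huB : ENNReal.ofReal (uB c ν) = ∫⁻ v, ENNReal.ofReal (b v) ∂ν :=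
    ofReal_integral_eq_lintegral_ofReal (integrable_iSup_buyer_utility c hc ν hν)
      (Filter.Eventually.of_forall hb0)
  have huSeq : uS c ν = ∫ q in Icc (0:ℝ) 1, s (c q) := by
    rw [integral_Icc_eq_integral_Ioc, ← intervalIntegral.integral_of_le zero_le_one]
    rfl
  have huS : ENNReal.ofReal (uS c ν) = ∫⁻ x, ENNReal.ofReal (s x) ∂σ := by
    rw [hσ, lintegral_map' hs.measurable.ennreal_ofReal.aemeasurable hcm, huSeq]
    exact ofReal_integral_eq_lintegral_ofReal
      ((hs.comp_monotoneOn hc).integrableOn_isCompact isCompact_Icc)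
      (Filter.Eventually.of_forall fun q => hs0 (c q))
  have hFB : ENNReal.ofReal (FB c ν) ≤ ∫⁻ v, ∫⁻ x, ENNReal.ofReal (v - x) ∂σ ∂ν := by
    refine (Real.ofReal_le_enorm _).trans ((enorm_integral_le_lintegral_enorm _).trans ?_)
    refine lintegral_mono fun v => ?_
    rw [intervalIntegral.integral_of_le zero_le_one, ← integral_Icc_eq_integral_Ioc, hσ,
      lintegral_map' (by fun_prop) hcm]
    refine (enorm_integral_le_lintegral_enorm _).trans (lintegral_mono fun q => ?_)
    rw [Real.enorm_of_nonneg (le_max_right _ _), ENNReal.ofReal_max, ENNReal.ofReal_zero]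
    simp
  have key := lintegral_gains_le_two_mul σ ν (b := fun v => ENNReal.ofReal (b v))
    (s := fun x => ENNReal.ofReal (s x)) hb.measurable.ennreal_ofReal
    (fun v p => by
      rw [← ofReal_accProb c hc p, ← ENNReal.ofReal_mul' (accProb_nonneg c p)]
      exact ENNReal.ofReal_le_ofReal (le_ciSup (bddAbove_buyer_utility c hc v) p))
    (fun x p => by
      rw [← ofReal_measureReal (μ := ν), ← ENNReal.ofReal_mul' measureReal_nonneg]
      exact ENNReal.ofReal_le_ofReal (le_ciSup (bddAbove_seller_utility ν hν x) p))
  have hB0 : 0 ≤ uB c ν := integral_nonneg hb0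
  have hS0 : 0 ≤ uS c ν := huSeq ▸ integral_nonneg fun q => hs0 (c q)
  have hfin : ENNReal.ofReal (FB c ν) ≤ ENNReal.ofReal (2 * (uB c ν + uS c ν)) := by
    rw [ENNReal.ofReal_mul zero_le_two, ENNReal.ofReal_add hB0 hS0, huB, huS,
      ENNReal.ofReal_ofNat]
    exact hFB.trans key
  have := (ENNReal.ofReal_le_ofReal_iff (by positivity)).1 hfin
  linarith
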